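/- For every integer L ≥ 1, every real SNR > 0, every g ∈ ℝ^L, and all positive reals b₁², …, b_L², there exist L vectors a₁, …, a_L ∈ ℤ^L that are linearly independent over ℝ and satisfy ∑_{m=1}^L (1/2)·log₂(SNR / σ²_eff(g, a_m, B; SNR)) ≥ (1/2)·log₂((1 + SNR·∑_{ℓ=1}^L g_ℓ²·b_ℓ²) / ∏_{ℓ=1}^L b_ℓ²) − (L/2)·log₂(L). -/

import Mathlib

open Finset

open Matrix MeasureTheory Module in
/-- Minkowski's convex body theorem for a cube. -/
theorem exists_int_mulVec_pow_le_abs_det {ι : Type*} [Fintype ι] [DecidableEq ι] [Nonempty ι]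
    (T : Matrix ι ι ℝ) (hT : T.det ≠ 0) :
    ∃ c : ι → ℤ, c ≠ 0 ∧
      ∀ i, |(T *ᵥ fun j => (c j : ℝ)) i| ^ Fintype.card ι ≤ |T.det| := by
  have hcard : Fintype.card ι ≠ 0 := Fintype.card_ne_zero
  have hli : LinearIndependent ℝ T.col :=
    linearIndependent_cols_iff_isUnit.2 ((isUnit_iff_isUnit_det T).2 hT.isUnit)
  let b := basisOfLinearIndependentOfCardEqFinrank hli (by simp)
  have hb : ⇑b = T.col := coe_basisOfLinearIndependentOfCardEqFinrank hli _
  set r : ℝ := |T.det| ^ ((Fintype.card ι : ℝ)⁻¹) with hr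
  have hr0 : 0 ≤ r := by positivity
  have hrpow : r ^ Fintype.card ι = |T.det| := Real.rpow_inv_natCast_pow (abs_nonneg _) hcard
  have hvol : volume (ZSpan.fundamentalDomain b) * 2 ^ finrank ℝ (ι → ℝ)
      ≤ volume (Metric.closedBall (0 : ι → ℝ) r) := by
    have hdet : (Matrix.of ⇑b).det = T.det := by
      rw [hb, ← det_transpose T]; rfl
    rw [ZSpan.volume_fundamentalDomain, hdet, Real.volume_pi_closedBall _ hr0, mul_pow, hrpow,
      mul_comm (2 ^ _), ENNReal.ofReal_mul (abs_nonneg _), finrank_fintype_fun_eq_card,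
      ENNReal.ofReal_pow (by norm_num)]
    simp
  have : Countable (Submodule.span ℤ (Set.range b)).toAddSubgroup :=
    inferInstanceAs (Countable (Submodule.span ℤ (Set.range b)))
  obtain ⟨⟨x, hx⟩, hx0, hxr⟩ := exists_ne_zero_mem_lattice_of_measure_mul_two_pow_le_measure
    (ZSpan.isAddFundamentalDomain' b volume) (fun x hx => by simpa using hx)
    (convex_closedBall _ _) (isCompact_closedBall _ _) hvol
  obtain ⟨c, hc⟩ := (Submodule.mem_span_range_iff_exists_fun ℤ).1 hx
  have hTc : (T *ᵥ fun j => (c j : ℝ)) = x := by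
    rw [← hc]
    ext i
    simp [hb, mulVec, dotProduct, mul_comm]
  refine ⟨c, ?_, fun i => ?_⟩
  · rintro rfl
    exact hx0 (Subtype.ext (by simpa using hc.symm))
  · rw [hTc, ← hrpow]
    have h : ‖x‖ ≤ r := by simpa using hxr
    exact pow_le_pow_left₀ (abs_nonneg _) ((norm_le_pi_norm x i).trans h) _

open Matrix in
theorem one_le_card_pow_mul_det_sq {ι : Type*} [Fintype ι] [DecidableEq ι] [Nonempty ι]
    (T : Matrix ι ι ℝ) (hT : T.det ≠ 0)
    (h : ∀ c : ι → ℤ, c ≠ 0 → 1 ≤ ∑ i, (T *ᵥ fun j => (c j : ℝ)) i ^ 2) :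
    1 ≤ (Fintype.card ι : ℝ) ^ Fintype.card ι * T.det ^ 2 := by
  obtain ⟨c, hc, hle⟩ := exists_int_mulVec_pow_le_abs_det T hT
  obtain ⟨k, -, hk⟩ := Finset.univ.exists_max_image
    (fun i => (T *ᵥ fun j => (c j : ℝ)) i ^ 2) Finset.univ_nonempty
  have h1 : 1 ≤ (Fintype.card ι : ℝ) * (T *ᵥ fun j => (c j : ℝ)) k ^ 2 := by
    refine (h c hc).trans ((Finset.sum_le_card_nsmul _ _ _ hk).trans_eq ?_)
    simp
  calc (1 : ℝ) ≤ ((Fintype.card ι : ℝ) * (T *ᵥ fun j => (c j : ℝ)) k ^ 2) ^ Fintype.card ι :=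
        one_le_pow₀ h1
    _ = (Fintype.card ι : ℝ) ^ Fintype.card ι *
          (|(T *ᵥ fun j => (c j : ℝ)) k| ^ Fintype.card ι) ^ 2 := by
        rw [mul_pow, ← sq_abs, ← pow_mul, ← pow_mul, mul_comm 2]
    _ ≤ (Fintype.card ι : ℝ) ^ Fintype.card ι * |T.det| ^ 2 := by
        gcongr
        exact hle k
    _ = _ := by rw [sq_abs]

open Matrix in
theorem finite_setOf_int_mulVec_sq_le {ι : Type*} [Fintype ι] [DecidableEq ι]
    (A : Matrix ι ι ℝ) (hA : A.det ≠ 0) (C : ℝ) :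
    {c : ι → ℤ | ∑ i, (A *ᵥ fun j => (c j : ℝ)) i ^ 2 ≤ C}.Finite := by
  have hemb : Topology.IsClosedEmbedding (fun c : ι → ℤ => A *ᵥ fun j => (c j : ℝ)) := by
    have h1 : Topology.IsClosedEmbedding (Pi.map fun (_ : ι) (n : ℤ) => (n : ℝ)) :=
      .piMap fun _ => Int.isClosedEmbedding_coe_real
    have h2 : Function.Injective (mulVecLin A) :=
      mulVec_injective_iff_isUnit.2 ((isUnit_iff_isUnit_det A).2 hA.isUnit)
    exact (LinearMap.isClosedEmbedding_of_injective (LinearMap.ker_eq_bot.2 h2)).comp h1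
  refine ((hemb.isCompact_preimage
    (isCompact_closedBall (0 : ι → ℝ) √C)).finite_of_discrete).subset fun c hc => ?_
  have hc : ∑ i, (A *ᵥ fun j => (c j : ℝ)) i ^ 2 ≤ C := hc
  rw [Set.mem_preimage, mem_closedBall_zero_iff, pi_norm_le_iff_of_nonneg (Real.sqrt_nonneg _)]
  intro i
  exact Real.abs_le_sqrt ((Finset.single_le_sum (f := fun i => (A *ᵥ fun j => (c j : ℝ)) i ^ 2)
    (fun _ _ => sq_nonneg _) (Finset.mem_univ i)).trans hc)

theorem exists_int_notMem_of_ne_top {ι : Type*} [Fintype ι] [DecidableEq ι]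
    (S : Submodule ℝ (ι → ℝ)) (hS : S ≠ ⊤) : ∃ c : ι → ℤ, (fun j => (c j : ℝ)) ∉ S := by
  by_contra! h
  refine hS (top_le_iff.1 ?_)
  rw [← (Pi.basisFun ℝ ι).span_eq, Submodule.span_le]
  rintro _ ⟨i, rfl⟩
  have hi : (Pi.basisFun ℝ ι) i = fun j => ((Pi.single i 1 : ι → ℤ) j : ℝ) := by
    ext j
    by_cases hij : j = i <;> simp [hij]
  exact hi ▸ h (Pi.single i 1)

/-- Greedy choice of integer vectors realizing the successive minima of a function `q` with finite
sublevel sets. -/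
theorem exists_linearIndependent_int_minimal {ι : Type*} [Fintype ι] [DecidableEq ι]
    (q : (ι → ℤ) → ℝ) (hq : ∀ C, {c | q c ≤ C}.Finite) (k : ℕ) (hk : k ≤ Fintype.card ι) :
    ∃ a : Fin k → ι → ℤ, LinearIndependent ℝ (fun m => fun i => (a m i : ℝ)) ∧
      ∀ (m : Fin k) (c : ι → ℤ),
        (fun i => (c i : ℝ)) ∉
          Submodule.span ℝ ((fun n => fun i => (a n i : ℝ)) '' Set.Iio m) → q (a m) ≤ q c := by
  induction k with
  | zero => exact ⟨Fin.elim0, linearIndependent_empty_type, fun m => m.elim0⟩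
  | succ k ih =>
    obtain ⟨a, hli, hmin⟩ := ih (by omega)
    set S := Submodule.span ℝ (Set.range fun m => fun i => (a m i : ℝ)) with hSdef
    have hS : S ≠ ⊤ := by
      intro h
      have h1 := finrank_span_eq_card hli
      rw [← hSdef, h, finrank_top] at h1
      simp at h1
      omega
    obtain ⟨c₀, hc₀⟩ := exists_int_notMem_of_ne_top S hS
    obtain ⟨x, ⟨hxq, hxS⟩, hx⟩ := Set.exists_min_image
      ({c | q c ≤ q c₀} ∩ {c | (fun j => (c j : ℝ)) ∉ S}) q ((hq _).inter_of_left _)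
      ⟨c₀, le_refl (q c₀), hc₀⟩
    have hsnoc : (fun m => fun i => ((Fin.snoc a x : Fin (k + 1) → ι → ℤ) m i : ℝ)) =
        (Fin.snoc (fun m => fun i => (a m i : ℝ)) (fun i => (x i : ℝ)) :
          Fin (k + 1) → ι → ℝ) := by
      ext m i
      refine Fin.lastCases ?_ (fun m => ?_) m <;> simp
    refine ⟨Fin.snoc a x, ?_, fun m c => ?_⟩
    · rw [hsnoc]
      exact linearIndependent_finSnoc.2 ⟨hli, hxS⟩
    · rw [hsnoc]
      refine Fin.lastCases ?_ (fun m => ?_) m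
      · intro hc
        have hc : (fun j => (c j : ℝ)) ∉ S := by
          refine fun h => hc (Submodule.span_mono ?_ h)
          rintro _ ⟨n, rfl⟩
          exact ⟨n.castSucc, Fin.castSucc_lt_last n, by simp⟩
        rw [Fin.snoc_last]
        rcases le_total (q c) (q c₀) with h | h
        · exact hx c ⟨h, hc⟩
        · exact le_trans hxq h
      · intro hc
        rw [Fin.snoc_castSucc]
        refine hmin m c fun h => hc (Submodule.span_mono ?_ h)
        rintro _ ⟨n, hn, rfl⟩
        exact ⟨n.castSucc, Fin.castSucc_lt_castSucc_iff.2 hn, by simp⟩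

open Matrix in
/-- **Minkowski's second theorem** for ellipsoids, with Hermite's constant bounded by `L`. -/
theorem exists_linearIndependent_int_prod_le {L : ℕ} (hL : 0 < L)
    (A : Matrix (Fin L) (Fin L) ℝ) (hA : A.det ≠ 0) :
    ∃ a : Fin L → Fin L → ℤ, LinearIndependent ℝ (fun m => fun i => (a m i : ℝ)) ∧
      ∏ m, ∑ i, (A *ᵥ fun j => (a m j : ℝ)) i ^ 2 ≤ (L : ℝ) ^ L * A.det ^ 2 := by
  have : Nonempty (Fin L) := ⟨⟨0, hL⟩⟩
  set q : (Fin L → ℤ) → ℝ := fun c => ∑ i, (A *ᵥ fun j => (c j : ℝ)) i ^ 2 with hq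
  obtain ⟨a, hli, hmin⟩ := exists_linearIndependent_int_minimal q
    (finite_setOf_int_mulVec_sq_le A hA) L (by simp)
  refine ⟨a, hli, ?_⟩
  set w : Fin L → Fin L → ℝ := fun m => fun i => (a m i : ℝ) with hw
  have hmono : ∀ {i k : Fin L}, i ≤ k → q (a i) ≤ q (a k) := fun {i k} hik =>
    hmin i (a k) (hli.notMem_span_image (s := Set.Iio i) (x := k) (by simpa using hik))
  have hpos : ∀ m, 0 < q (a m) := fun m => by
    refine lt_of_le_of_ne (by positivity) fun h => hli.ne_zero m ?_
    refine mulVec_injective_iff_isUnit.2 ((isUnit_iff_isUnit_det A).2 hA.isUnit) ?_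
    ext i
    have := (Finset.sum_eq_zero_iff_of_nonneg (fun i _ => sq_nonneg _)).1 h.symm i
      (Finset.mem_univ i)
    simpa using this
  let φ : (Fin L → ℝ) →ₗ[ℝ] EuclideanSpace ℝ (Fin L) :=
    (WithLp.linearEquiv 2 ℝ (Fin L → ℝ)).symm.toLinearMap ∘ₗ A.mulVecLin
  let e := InnerProductSpace.gramSchmidtOrthonormalBasis (𝕜 := ℝ)
    (finrank_euclideanSpace (𝕜 := ℝ) (ι := Fin L)) (fun m => φ (w m))
  let O : Matrix (Fin L) (Fin L) ℝ := Matrix.of fun i j => e i j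
  have hO : O * Oᵀ = 1 := by
    ext i j
    have h := orthonormal_iff_ite.1 e.orthonormal j i
    rw [PiLp.inner_apply] at h
    simpa [O, mul_apply, one_apply, eq_comm] using h
  have hO2 : O.det ^ 2 = 1 := by
    have h := congrArg det hO
    rwa [det_mul, det_transpose, det_one, ← sq] at h
  let T := diagonal (fun i => (√(q (a i)))⁻¹) * (O * A)
  have hTdet : T.det ^ 2 = A.det ^ 2 / ∏ m, q (a m) := by
    simp only [T, det_mul, det_diagonal, mul_pow, hO2, one_mul, ← Finset.prod_pow, inv_pow,
      Real.sq_sqrt (hpos _).le, Finset.prod_inv_distrib]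
    rw [div_eq_inv_mul]
  have hprod : 0 < ∏ m, q (a m) := Finset.prod_pos fun m _ => hpos m
  have hT0 : T.det ≠ 0 := by
    intro h
    rw [h] at hTdet
    have : 0 < A.det ^ 2 / ∏ m, q (a m) := by positivity
    simp [← hTdet] at this
  have hTc : ∀ x i, (T *ᵥ x) i ^ 2 = inner ℝ (e i) (φ x) ^ 2 / q (a i) := by
    intro x i
    have h : ((O * A) *ᵥ x) i = inner ℝ (e i) (φ x) := by
      rw [← mulVec_mulVec, PiLp.inner_apply]
      simp [O, φ, mulVec, dotProduct, mul_comm]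
    rw [← h]
    simp only [T]
    rw [← mulVec_mulVec, mulVec_diagonal, mul_pow, inv_pow, Real.sq_sqrt (hpos i).le]
    field_simp
  have hqe : ∀ c : Fin L → ℤ, q c = ∑ i, inner ℝ (e i) (φ fun j => (c j : ℝ)) ^ 2 := by
    intro c
    have h := e.sum_sq_norm_inner_right (φ fun j => (c j : ℝ))
    rw [EuclideanSpace.norm_sq_eq] at h
    simpa [q, φ] using h.symm
  have hspan : Submodule.span ℝ (Set.range w) = ⊤ :=
    hli.span_eq_top_of_card_eq_finrank' (by simp)
  have key := one_le_card_pow_mul_det_sq T hT0 fun c hc => by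
    set x : Fin L → ℝ := fun j => (c j : ℝ) with hx
    have hex : ∃ k : Fin L, x ∈ Submodule.span ℝ (w '' Set.Iic k) := by
      refine ⟨⟨L - 1, by omega⟩, ?_⟩
      have : Set.Iic (⟨L - 1, by omega⟩ : Fin L) = Set.univ := by
        ext i
        simp [Fin.le_def]
        omega
      rw [this, Set.image_univ, hspan]
      trivial
    obtain ⟨k, hk, hkmin⟩ : ∃ k : Fin L, x ∈ Submodule.span ℝ (w '' Set.Iic k) ∧
        ∀ i < k, x ∉ Submodule.span ℝ (w '' Set.Iic i) := by
      obtain ⟨k, hk, hkm⟩ := WellFounded.has_min (wellFounded_lt (α := Fin L)) _ hex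
      exact ⟨k, hk, fun i hi h => hkm i h hi⟩
    have hxk : x ∉ Submodule.span ℝ (w '' Set.Iio k) := by
      rcases Nat.eq_zero_or_pos k.1 with h0 | h0
      · have : Set.Iio k = ∅ := by
          ext i
          simp [Fin.le_def, h0]
        rw [this]
        simp only [Set.image_empty, Submodule.span_empty, Submodule.mem_bot]
        intro h
        exact hc (funext fun j => by simpa [hx] using congrFun h j)
      · refine fun h => hkmin ⟨k - 1, by omega⟩ (by simp [Fin.lt_def]; omega)
          (Submodule.span_mono (Set.image_mono fun i hi => ?_) h)
        simp only [Set.mem_Iio, Set.mem_Iic, Fin.lt_def, Fin.le_def] at hi ⊢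
        omega
    have hqk : q (a k) ≤ q c := hmin k c hxk
    have hzero : ∀ i, k < i → inner ℝ (e i) (φ x) = 0 := by
      intro i hi
      have hle : Submodule.span ℝ (w '' Set.Iic k) ≤
          LinearMap.ker ((innerₛₗ ℝ (e i)) ∘ₗ φ) := by
        rw [Submodule.span_le]
        rintro _ ⟨j, hj, rfl⟩
        simpa using InnerProductSpace.gramSchmidtOrthonormalBasis_inv_triangular
          (𝕜 := ℝ) (finrank_euclideanSpace (𝕜 := ℝ) (ι := Fin L)) (fun m => φ (w m))
          (lt_of_le_of_lt hj hi)
      simpa using hle hk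
    calc 1 ≤ q c / q (a k) := (one_le_div (hpos k)).2 hqk
      _ = ∑ i, inner ℝ (e i) (φ x) ^ 2 / q (a k) := by rw [hqe, Finset.sum_div]
      _ ≤ ∑ i, (T *ᵥ x) i ^ 2 := by
        refine Finset.sum_le_sum fun i _ => ?_
        rw [hTc]
        rcases le_or_gt i k with h | h
        · exact div_le_div_of_nonneg_left (sq_nonneg _) (hpos i) (hmono h)
        · simp [hzero i h]
  rw [hTdet, Fintype.card_fin, ← mul_div_assoc, one_le_div hprod] at key
  exact key

open Matrix in
theorem exists_linearIndependent_int_prod_le_of_posDef {L : ℕ} (hL : 0 < L)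
    (Q : Matrix (Fin L) (Fin L) ℝ) (hQ : Q.PosDef) :
    ∃ a : Fin L → Fin L → ℤ, LinearIndependent ℝ (fun m => fun i => (a m i : ℝ)) ∧
      ∏ m, (fun j => (a m j : ℝ)) ⬝ᵥ Q *ᵥ (fun j => (a m j : ℝ)) ≤ (L : ℝ) ^ L * Q.det := by
  open scoped MatrixOrder in
  obtain ⟨A, rfl⟩ := CStarAlgebra.nonneg_iff_eq_star_mul_self.mp hQ.posSemidef.nonneg
  rw [star_eq_conjTranspose, conjTranspose_eq_transpose_of_trivial] at hQ ⊢
  have hdet : (Aᵀ * A).det = A.det ^ 2 := by rw [det_mul, det_transpose, sq]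
  have hA : A.det ≠ 0 := by
    intro h
    have := hQ.det_pos
    simp [hdet, h] at this
  obtain ⟨a, hli, h⟩ := exists_linearIndependent_int_prod_le hL A hA
  refine ⟨a, hli, ?_⟩
  rw [hdet]
  refine (Finset.prod_congr rfl fun m _ => ?_).trans_le h
  rw [← mulVec_mulVec, dotProduct_mulVec, vecMul_transpose]
  simp [dotProduct, sq]

section EffectiveNoise

variable {ι : Type*} [Fintype ι]

/-- The objective minimized by the effective noise variance, in completed-square form. -/
theorem effNoise_objective_eq (S : ℝ) (hS : 0 < S) (g b x : ι → ℝ) (hb : ∀ i, 0 < b i) (β : ℝ) :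
    S * (∑ i, b i * (β * g i - x i) ^ 2) + β ^ 2 =
      (1 + S * ∑ i, g i ^ 2 * b i) *
          (β - S * (∑ i, b i * g i * x i) / (1 + S * ∑ i, g i ^ 2 * b i)) ^ 2 +
        (S * (∑ i, b i * x i ^ 2) -
          S ^ 2 * (∑ i, b i * g i * x i) ^ 2 / (1 + S * ∑ i, g i ^ 2 * b i)) := by
  have hG : 0 ≤ ∑ i, g i ^ 2 * b i :=
    Finset.sum_nonneg fun i _ => mul_nonneg (sq_nonneg _) (hb i).le
  have hD : 1 + S * ∑ i, g i ^ 2 * b i ≠ 0 := by positivity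
  have h : ∑ i, b i * (β * g i - x i) ^ 2 =
      β ^ 2 * (∑ i, g i ^ 2 * b i) - 2 * β * (∑ i, b i * g i * x i) + ∑ i, b i * x i ^ 2 := by
    simp only [Finset.mul_sum, ← Finset.sum_sub_distrib, ← Finset.sum_add_distrib]
    exact Finset.sum_congr rfl fun i _ => by ring
  rw [h]
  field_simp
  ring

theorem iInf_effNoise_objective (S : ℝ) (hS : 0 < S) (g b x : ι → ℝ) (hb : ∀ i, 0 < b i) :
    (⨅ β : ℝ, S * (∑ i, b i * (β * g i - x i) ^ 2) + β ^ 2) =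
      S * (∑ i, b i * x i ^ 2) -
        S ^ 2 * (∑ i, b i * g i * x i) ^ 2 / (1 + S * ∑ i, g i ^ 2 * b i) := by
  have hG : 0 ≤ ∑ i, g i ^ 2 * b i :=
    Finset.sum_nonneg fun i _ => mul_nonneg (sq_nonneg _) (hb i).le
  simp only [effNoise_objective_eq S hS g b x hb]
  refine IsLeast.csInf_eq
    ⟨⟨S * (∑ i, b i * g i * x i) / (1 + S * ∑ i, g i ^ 2 * b i), by simp⟩, ?_⟩
  rintro _ ⟨β, rfl⟩
  exact le_add_of_nonneg_left (by positivity)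

theorem effNoise_pos (S : ℝ) (hS : 0 < S) (g b x : ι → ℝ) (hb : ∀ i, 0 < b i) (hx : x ≠ 0) :
    0 < S * (∑ i, b i * x i ^ 2) -
        S ^ 2 * (∑ i, b i * g i * x i) ^ 2 / (1 + S * ∑ i, g i ^ 2 * b i) := by
  set β := S * (∑ i, b i * g i * x i) / (1 + S * ∑ i, g i ^ 2 * b i) with hβ
  have h := effNoise_objective_eq S hS g b x hb β
  rw [← hβ, sub_self, zero_pow two_ne_zero, mul_zero, zero_add] at h
  rw [← h]
  have hnn : ∀ i ∈ Finset.univ, 0 ≤ b i * (β * g i - x i) ^ 2 := fun i _ =>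
    mul_nonneg (hb i).le (sq_nonneg _)
  rcases eq_or_ne β 0 with h0 | h0
  · obtain ⟨i, hi⟩ := Function.ne_iff.1 hx
    have : 0 < ∑ i, b i * (β * g i - x i) ^ 2 := by
      refine Finset.sum_pos' hnn ⟨i, Finset.mem_univ i, mul_pos (hb i) ?_⟩
      have : x i ≠ 0 := hi
      rw [h0]
      simp only [zero_mul, zero_sub, even_two, Even.neg_pow]
      positivity
    positivity
  · have := Finset.sum_nonneg hnn
    positivity

open Matrix

variable [DecidableEq ι]

/-- The Gram matrix of the quadratic form given by the effective noise variance. -/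
noncomputable def effNoiseMatrix (S : ℝ) (g b : ι → ℝ) : Matrix ι ι ℝ :=
  diagonal (fun i => S * b i) * (1 + replicateCol Unit
    (fun i => -(S / (1 + S * ∑ i, g i ^ 2 * b i)) * g i) * replicateRow Unit fun i => b i * g i)

theorem effNoiseMatrix_apply (S : ℝ) (g b : ι → ℝ) (i j : ι) :
    effNoiseMatrix S g b i j = (if i = j then S * b i else 0) -
      S ^ 2 / (1 + S * ∑ i, g i ^ 2 * b i) * (b i * g i) * (b j * g j) := by
  rw [effNoiseMatrix, diagonal_mul, Matrix.add_apply, one_apply]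
  simp only [mul_apply, replicateCol_apply, replicateRow_apply, Finset.univ_unique,
    Finset.sum_singleton]
  split_ifs <;> ring

theorem dotProduct_effNoiseMatrix_mulVec (S : ℝ) (g b x : ι → ℝ) :
    x ⬝ᵥ effNoiseMatrix S g b *ᵥ x = S * (∑ i, b i * x i ^ 2) -
      S ^ 2 * (∑ i, b i * g i * x i) ^ 2 / (1 + S * ∑ i, g i ^ 2 * b i) := by
  have h : ∀ i, (effNoiseMatrix S g b *ᵥ x) i = S * b i * x i -
      S ^ 2 / (1 + S * ∑ i, g i ^ 2 * b i) * (b i * g i) * ∑ j, b j * g j * x j := by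
    intro i
    simp only [mulVec, dotProduct, effNoiseMatrix_apply, sub_mul, Finset.sum_sub_distrib,
      ite_mul, zero_mul, Finset.sum_ite_eq, Finset.mem_univ, if_true, Finset.mul_sum]
    congr 1
    exact Finset.sum_congr rfl fun j _ => by ring
  simp only [dotProduct, h, mul_sub, Finset.sum_sub_distrib]
  congr 1
  · rw [Finset.mul_sum]
    exact Finset.sum_congr rfl fun j _ => by ring
  · generalize 1 + S * ∑ i, g i ^ 2 * b i = D
    rw [sq (∑ i, b i * g i * x i), mul_div_right_comm, ← mul_assoc,
      Finset.mul_sum univ _ (S ^ 2 / D), Finset.sum_mul]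
    exact Finset.sum_congr rfl fun j _ => by ring

theorem det_effNoiseMatrix (S : ℝ) (hS : 0 < S) (g b : ι → ℝ) (hb : ∀ i, 0 < b i) :
    (effNoiseMatrix S g b).det =
      S ^ Fintype.card ι * (∏ i, b i) / (1 + S * ∑ i, g i ^ 2 * b i) := by
  have hG : 0 ≤ ∑ i, g i ^ 2 * b i :=
    Finset.sum_nonneg fun i _ => mul_nonneg (sq_nonneg _) (hb i).le
  have hdot : (fun i => b i * g i) ⬝ᵥ (fun i => -(S / (1 + S * ∑ i, g i ^ 2 * b i)) * g i) =
      -(S / (1 + S * ∑ i, g i ^ 2 * b i)) * ∑ i, g i ^ 2 * b i := by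
    generalize 1 + S * ∑ i, g i ^ 2 * b i = D
    simp only [dotProduct]
    rw [Finset.mul_sum]
    exact Finset.sum_congr rfl fun j _ => by ring
  rw [effNoiseMatrix, det_mul, det_diagonal, det_one_add_replicateCol_mul_replicateRow, hdot,
    Finset.prod_mul_distrib, Finset.prod_const, Finset.card_univ]
  field_simp
  ring

theorem posDef_effNoiseMatrix (S : ℝ) (hS : 0 < S) (g b : ι → ℝ) (hb : ∀ i, 0 < b i) :
    (effNoiseMatrix S g b).PosDef := by
  refine .of_dotProduct_mulVec_pos ?_ fun x hx => ?_
  · ext i j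
    rw [conjTranspose_apply, star_trivial, effNoiseMatrix_apply, effNoiseMatrix_apply]
    by_cases h : i = j
    · simp [h]
    · rw [if_neg h, if_neg (Ne.symm h)]
      ring
  · rw [star_trivial, dotProduct_effNoiseMatrix_mulVec]
    exact effNoise_pos S hS g b x hb hx

end EffectiveNoise

/-- For every integer `L ≥ 1`, `SNR > 0`, `g ∈ ℝ^L`, and positive weights
`b₁², …, b_L²`, there exist `L` integer vectors `a₁, …, a_L ∈ ℤ^L`, linearly independent
over `ℝ`, whose weighted computation rates sum to at least
`(1/2)·log₂((1 + SNR·∑ g_ℓ²·b_ℓ²)/∏ b_ℓ²) − (L/2)·log₂ L`. -/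
theorem stmt3 (L : ℕ) (hL : 1 ≤ L) (SNR : ℝ) (hSNR : 0 < SNR)
    (g : Fin L → ℝ) (b : Fin L → ℝ) (hb : ∀ ℓ, 0 < b ℓ) :
    ∃ a : Fin L → (Fin L → ℤ),
      LinearIndependent ℝ (fun m => fun i => ((a m i : ℝ))) ∧
      ∑ m, (1 / 2 : ℝ) *
          Real.logb 2 (SNR /
            (⨅ β : ℝ, SNR * (∑ ℓ, b ℓ * (β * g ℓ - (a m ℓ : ℝ)) ^ 2) + β ^ 2))
        ≥ (1 / 2 : ℝ) * Real.logb 2 ((1 + SNR * ∑ ℓ, (g ℓ) ^ 2 * b ℓ) / ∏ ℓ, b ℓ)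
            - ((L : ℝ) / 2) * Real.logb 2 L := by
  obtain ⟨a, hli, hprod⟩ := exists_linearIndependent_int_prod_le_of_posDef hL
    (effNoiseMatrix SNR g b) (posDef_effNoiseMatrix SNR hSNR g b hb)
  refine ⟨a, hli, ?_⟩
  have hG : 0 ≤ ∑ ℓ, g ℓ ^ 2 * b ℓ :=
    Finset.sum_nonneg fun ℓ _ => mul_nonneg (sq_nonneg _) (hb ℓ).le
  have hB : 0 < ∏ ℓ, b ℓ := Finset.prod_pos fun ℓ _ => hb ℓ
  have hLpos : (0 : ℝ) < L := by exact_mod_cast hL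
  set σ : Fin L → ℝ := fun m =>
    ⨅ β : ℝ, SNR * (∑ ℓ, b ℓ * (β * g ℓ - (a m ℓ : ℝ)) ^ 2) + β ^ 2 with hσ
  have hσpos : ∀ m, 0 < σ m := fun m => by
    simp only [hσ, iInf_effNoise_objective SNR hSNR g b _ hb]
    exact effNoise_pos SNR hSNR g b _ hb (hli.ne_zero m)
  have hσprod : ∏ m, σ m ≤
      (L : ℝ) ^ L * (SNR ^ L * (∏ ℓ, b ℓ) / (1 + SNR * ∑ ℓ, g ℓ ^ 2 * b ℓ)) := by
    rw [det_effNoiseMatrix SNR hSNR g b hb, Fintype.card_fin] at hprod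
    refine (Finset.prod_congr rfl fun m _ => ?_).trans_le hprod
    simp only [hσ, iInf_effNoise_objective SNR hSNR g b _ hb, dotProduct_effNoiseMatrix_mulVec]
  have hσprodpos : 0 < ∏ m, σ m := Finset.prod_pos fun m _ => hσpos m
  have hlog : Real.logb 2 ((1 + SNR * ∑ ℓ, g ℓ ^ 2 * b ℓ) / ∏ ℓ, b ℓ) ≤
      L * Real.logb 2 L + ∑ m, Real.logb 2 (SNR / σ m) := by
    rw [← Real.logb_prod _ _ (fun m _ => (div_pos hSNR (hσpos m)).ne'), ← Real.logb_pow,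
      ← Real.logb_mul (by positivity) (Finset.prod_pos fun m _ => div_pos hSNR (hσpos m)).ne',
      Finset.prod_div_distrib, Finset.prod_const, Finset.card_univ, Fintype.card_fin]
    refine Real.logb_le_logb_of_le one_lt_two (by positivity) ?_
    rw [← mul_div_assoc, div_le_div_iff₀ hB hσprodpos]
    rw [← mul_div_assoc, le_div_iff₀ (by positivity)] at hσprod
    linarith
  rw [← Finset.mul_sum]
  linarith
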